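/- Assume additionally ε ≤ d−1. For any λ > 0 and any positive integer N with N ≥ 2(e^ε+1)²(1+λ)²/(0.24²·λ²)·ln(8(1+λ)/(0.24·λ)), for every deterministic one-hot input x: E[‖x̂^mmrc − x‖²] ≤ (1 + 4λ + 5λ² + 2λ³)·E[‖x̂^ss − x‖²], where the left expectation is over the i.i.d. uniform candidates and the selected index K of MMRC simulating Subset Selection, and the right expectation is over z ~ q^ss(·|x). -/

import Mathlib

open scoped Classical
open Real Finset

noncomputable section

/-- The output alphabet of Subset Selection: subsets of `[d]` of size `s`. -/
def zset (d s : ℕ) : Finset (Finset (Fin d)) := Finset.powersetCard s Finset.univ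

/-- Normalizing constant of the Subset Selection pmf. -/
def qssC (d s : ℕ) (ε : ℝ) : ℝ :=
  ((d - 1).choose (s - 1) : ℝ) * Real.exp ε + ((d - 1).choose s : ℝ)

/-- The Subset Selection pmf `q^ss(A | e_j)`. -/
def qss (d s : ℕ) (ε : ℝ) (j : Fin d) (A : Finset (Fin d)) : ℝ :=
  if j ∈ A then Real.exp ε / qssC d s ε else 1 / qssC d s ε

/-- Subset Selection scaling factor `m_ss`. -/
def mss (d s : ℕ) (ε : ℝ) : ℝ :=
  (s : ℝ) * ((d : ℝ) - (s : ℝ)) * (Real.exp ε - 1) /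
    (((d : ℝ) - 1) * ((s : ℝ) * (Real.exp ε - 1) + (d : ℝ)))

/-- Subset Selection offset `b_ss`. -/
def bss (d s : ℕ) (ε : ℝ) : ℝ :=
  (s : ℝ) * (((s : ℝ) - 1) * Real.exp ε + ((d : ℝ) - (s : ℝ))) /
    (((d : ℝ) - 1) * ((s : ℝ) * (Real.exp ε - 1) + (d : ℝ)))

/-- The Subset Selection estimator `x̂^ss = (z − b_ss·𝟙)/m_ss`, coordinate `i`. -/
def xhatSS (d s : ℕ) (ε : ℝ) (A : Finset (Fin d)) (i : Fin d) : ℝ :=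
  ((if i ∈ A then (1 : ℝ) else 0) - bss d s ε) / mss d s ε

/-- Expectation of `f(M/N)` for `M ~ Binomial(N, μ)`. -/
def binomExp (N : ℕ) (μ : ℝ) (f : ℝ → ℝ) : ℝ :=
  ∑ M ∈ Finset.range (N + 1),
    (N.choose M : ℝ) * μ ^ M * (1 - μ) ^ (N - M) * f ((M : ℝ) / (N : ℝ))

/-- The in-cap selection probability of MRC given in-cap fraction `θ`. -/
def hMrc (ε θ : ℝ) : ℝ := Real.exp ε * θ / (Real.exp ε * θ + (1 - θ))

/-- MRC-simulating-Subset-Selection offset `b_mrc`. -/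
def bMrcSS (d s N : ℕ) (ε : ℝ) : ℝ :=
  (1 / ((d : ℝ) - 1)) * binomExp N ((s : ℝ) / (d : ℝ)) (fun θ => (s : ℝ) - hMrc ε θ)

/-- MRC-simulating-Subset-Selection scaling factor `m_mrc`. -/
def mMrcSS (d s N : ℕ) (ε : ℝ) : ℝ :=
  binomExp N ((s : ℝ) / (d : ℝ)) (hMrc ε) - bMrcSS d s N ε

/-- The MRC index distribution simulating Subset Selection:
`P(K = k) ∝ e^ε` for in-cap candidates and `∝ 1` for out-cap candidates. -/
def piMrcSS (d N : ℕ) (ε : ℝ) (j : Fin d) (zs : Fin N → Finset (Fin d)) (k : Fin N) : ℝ :=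
  (if j ∈ zs k then Real.exp ε else 1) /
    ∑ k' : Fin N, (if j ∈ zs k' then Real.exp ε else 1)

/-- Marginal output distribution of MRC simulating Subset Selection over
i.i.d. uniform candidates and the selected index. -/
def qMrcOut (d s N : ℕ) (ε : ℝ) (j : Fin d) (A : Finset (Fin d)) : ℝ :=
  ∑ zs ∈ Fintype.piFinset (fun _ : Fin N => zset d s),
    (1 / ((zset d s).card : ℝ)) ^ N *
      ∑ k : Fin N, if zs k = A then piMrcSS d N ε j zs k else 0

/-- The debiased MRC estimator `x̂^mrc = (Z_K − b_mrc·𝟙)/m_mrc`, coordinate `i`. -/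
def xhatMrc (d s N : ℕ) (ε : ℝ) (A : Finset (Fin d)) (i : Fin d) : ℝ :=
  ((if i ∈ A then (1 : ℝ) else 0) - bMrcSS d s N ε) / mMrcSS d s N ε

/-- The MMRC index distribution simulating Subset Selection (with `μ = s/d` and
`a = e^ε·μ + (1−μ)`). -/
def piMmrcSS (d s N : ℕ) (ε : ℝ) (j : Fin d) (zs : Fin N → Finset (Fin d)) (k : Fin N) : ℝ :=
  let θ : ℝ := ((Finset.univ.filter fun i : Fin N => j ∈ zs i).card : ℝ) / (N : ℝ)
  let μ : ℝ := (s : ℝ) / (d : ℝ)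
  let a : ℝ := Real.exp ε * μ + (1 - μ)
  if θ < μ then
    (if j ∈ zs k then Real.exp ε / ((N : ℝ) * a)
     else (1 - θ * Real.exp ε / a) / ((N : ℝ) * (1 - θ)))
  else if μ < θ then
    (if j ∈ zs k then (1 - (1 - θ) / a) / ((N : ℝ) * θ) else 1 / ((N : ℝ) * a))
  else
    (if j ∈ zs k then Real.exp ε / ((N : ℝ) * (Real.exp ε * θ + (1 - θ)))
     else 1 / ((N : ℝ) * (Real.exp ε * θ + (1 - θ))))

/-- `g(θ) = (e^ε θ/a)·1{θ≤μ} + ((e^ε μ + θ − μ)/a)·1{θ>μ}`. -/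
def gMmrc (ε μ θ : ℝ) : ℝ :=
  if θ ≤ μ then Real.exp ε * θ / (Real.exp ε * μ + (1 - μ))
  else (Real.exp ε * μ + θ - μ) / (Real.exp ε * μ + (1 - μ))

/-- `E[g(θ)]` over `N·θ ~ Binomial(N, s/d)`. -/
def egMmrc (d s N : ℕ) (ε : ℝ) : ℝ :=
  binomExp N ((s : ℝ) / (d : ℝ)) (gMmrc ε ((s : ℝ) / (d : ℝ)))

/-- MMRC-simulating-Subset-Selection scaling factor `m_mmrc`. -/
def mMmrcSS (d s N : ℕ) (ε : ℝ) : ℝ :=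
  ((d : ℝ) / ((d : ℝ) - 1)) * egMmrc d s N ε - (s : ℝ) / ((d : ℝ) - 1)

/-- MMRC-simulating-Subset-Selection offset `b_mmrc`. -/
def bMmrcSS (d s N : ℕ) (ε : ℝ) : ℝ :=
  (1 / ((d : ℝ) - 1)) * ((s : ℝ) - egMmrc d s N ε)

/-- Marginal output distribution of MMRC simulating Subset Selection over
i.i.d. uniform candidates and the selected index. -/
def qMmrcOut (d s N : ℕ) (ε : ℝ) (j : Fin d) (A : Finset (Fin d)) : ℝ :=
  ∑ zs ∈ Fintype.piFinset (fun _ : Fin N => zset d s),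
    (1 / ((zset d s).card : ℝ)) ^ N *
      ∑ k : Fin N, if zs k = A then piMmrcSS d s N ε j zs k else 0

/-- The debiased MMRC estimator `x̂^mmrc = (Z_K − b_mmrc·𝟙)/m_mmrc`, coordinate `i`. -/
def xhatMmrc (d s N : ℕ) (ε : ℝ) (A : Finset (Fin d)) (i : Fin d) : ℝ :=
  ((if i ∈ A then (1 : ℝ) else 0) - bMmrcSS d s N ε) / mMmrcSS d s N ε

/-- Per-user expected squared error of Subset Selection on one-hot input `e_j`. -/
def errSSone (d s : ℕ) (ε : ℝ) (j : Fin d) : ℝ :=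
  ∑ A ∈ zset d s, qss d s ε j A *
    ∑ i : Fin d, (xhatSS d s ε A i - (if i = j then (1 : ℝ) else 0)) ^ 2

/-- Per-user expected squared error of MRC simulating Subset Selection on input `e_j`. -/
def errMrcOne (d s N : ℕ) (ε : ℝ) (j : Fin d) : ℝ :=
  ∑ A ∈ zset d s, qMrcOut d s N ε j A *
    ∑ i : Fin d, (xhatMrc d s N ε A i - (if i = j then (1 : ℝ) else 0)) ^ 2

/-- Per-user expected squared error of MMRC simulating Subset Selection on input `e_j`. -/
def errMmrcOne (d s N : ℕ) (ε : ℝ) (j : Fin d) : ℝ :=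
  ∑ A ∈ zset d s, qMmrcOut d s N ε j A *
    ∑ i : Fin d, (xhatMmrc d s N ε A i - (if i = j then (1 : ℝ) else 0)) ^ 2

/-- `n`-user frequency-estimation squared error of Subset Selection on inputs
`e_{xs 1}, …, e_{xs n}`. -/
def errSSMech (d s n : ℕ) (ε : ℝ) (xs : Fin n → Fin d) : ℝ :=
  ∑ zt ∈ Fintype.piFinset (fun _ : Fin n => zset d s),
    (∏ i : Fin n, qss d s ε (xs i) (zt i)) *
      ∑ j : Fin d,
        ((1 / (n : ℝ)) * (∑ i : Fin n, xhatSS d s ε (zt i) j) -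
            (1 / (n : ℝ)) * (∑ i : Fin n, if j = xs i then (1 : ℝ) else 0)) ^ 2

/-- `n`-user frequency-estimation squared error of MMRC simulating Subset Selection. -/
def errMmrcMech (d s N n : ℕ) (ε : ℝ) (xs : Fin n → Fin d) : ℝ :=
  ∑ zt ∈ Fintype.piFinset (fun _ : Fin n => zset d s),
    (∏ i : Fin n, qMmrcOut d s N ε (xs i) (zt i)) *
      ∑ j : Fin d,
        ((1 / (n : ℝ)) * (∑ i : Fin n, xhatMmrc d s N ε (zt i) j) -
            (1 / (n : ℝ)) * (∑ i : Fin n, if j = xs i then (1 : ℝ) else 0)) ^ 2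

lemma binomExp_add (N : ℕ) (μ : ℝ) (f g : ℝ → ℝ) :
    binomExp N μ (fun θ => f θ + g θ) = binomExp N μ f + binomExp N μ g := by
  simp only [binomExp, mul_add, Finset.sum_add_distrib]

lemma binomExp_const_mul (N : ℕ) (μ c : ℝ) (f : ℝ → ℝ) :
    binomExp N μ (fun θ => c * f θ) = c * binomExp N μ f := by
  simp only [binomExp, Finset.mul_sum]
  exact Finset.sum_congr rfl fun _ _ => by ring

lemma binomExp_mono {N : ℕ} {μ : ℝ} (h0 : 0 ≤ μ) (h1 : μ ≤ 1) {f g : ℝ → ℝ}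
    (hfg : ∀ θ, f θ ≤ g θ) : binomExp N μ f ≤ binomExp N μ g := by
  have h1' : 0 ≤ 1 - μ := sub_nonneg.2 h1
  exact Finset.sum_le_sum fun _ _ => mul_le_mul_of_nonneg_left (hfg _) (by positivity)

lemma binomExp_const (N : ℕ) (μ c : ℝ) : binomExp N μ (fun _ => c) = c := by
  have h := congrArg (Polynomial.eval μ) (bernsteinPolynomial.sum ℝ N)
  simp only [bernsteinPolynomial, Polynomial.eval_finsetSum, Polynomial.eval_mul,
    Polynomial.eval_pow, Polynomial.eval_sub, Polynomial.eval_natCast, Polynomial.eval_X,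
    Polynomial.eval_one] at h
  rw [binomExp, ← Finset.sum_mul, h, one_mul]

lemma binomExp_sub_mean {N : ℕ} (hN : 0 < N) (μ : ℝ) : binomExp N μ (fun θ => θ - μ) = 0 := by
  have hN' : (N : ℝ) ≠ 0 := by positivity
  have h := congrArg (fun p => Polynomial.eval μ p / N) (bernsteinPolynomial.sum_smul ℝ N)
  simp only [bernsteinPolynomial, Polynomial.eval_finsetSum, Polynomial.eval_mul, nsmul_eq_mul,
    Polynomial.eval_pow, Polynomial.eval_sub, Polynomial.eval_natCast, Polynomial.eval_X,
    Polynomial.eval_one, Finset.sum_div] at h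
  have key : binomExp N μ (fun θ => θ) = μ := by
    rw [mul_div_cancel_left₀ _ hN'] at h
    exact (Finset.sum_congr rfl fun _ _ => by ring).trans h
  have := binomExp_add N μ (fun θ => θ) (fun _ => -μ)
  rw [key, binomExp_const] at this
  simpa [sub_eq_add_neg] using this

lemma binomExp_variance {N : ℕ} (hN : 0 < N) (μ : ℝ) :
    binomExp N μ (fun θ => (θ - μ) ^ 2) = μ * (1 - μ) / N := by
  have hN' : (N : ℝ) ≠ 0 := by positivity
  have h := congrArg (fun p => Polynomial.eval μ p / (N : ℝ) ^ 2)
    (bernsteinPolynomial.variance ℝ N)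
  simp only [bernsteinPolynomial, Polynomial.eval_finsetSum, Polynomial.eval_mul, nsmul_eq_mul,
    Polynomial.eval_pow, Polynomial.eval_sub, Polynomial.eval_natCast, Polynomial.eval_X,
    Polynomial.eval_one, Finset.sum_div] at h
  trans (N : ℝ) * μ * (1 - μ) / (N : ℝ) ^ 2
  · rw [← h]
    exact Finset.sum_congr rfl fun _ _ => by field_simp; ring
  · field_simp

lemma binomExp_abs_sub_le {N : ℕ} (hN : 0 < N) {μ δ : ℝ} (h0 : 0 ≤ μ) (h1 : μ ≤ 1) (hδ : 0 < δ)
    (h : μ * (1 - μ) / N ≤ δ ^ 2) : binomExp N μ (fun θ => |θ - μ|) ≤ δ := by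
  calc binomExp N μ (fun θ => |θ - μ|)
      ≤ binomExp N μ (fun θ => 1 / (2 * δ) * (θ - μ) ^ 2 + δ / 2) := by
        refine binomExp_mono h0 h1 fun θ => ?_
        have : 1 / (2 * δ) * (θ - μ) ^ 2 + δ / 2 - |θ - μ| = (|θ - μ| - δ) ^ 2 / (2 * δ) := by
          rw [← sq_abs (θ - μ)]
          field_simp
          ring
        have h2 : 0 ≤ (|θ - μ| - δ) ^ 2 / (2 * δ) := by positivity
        linarith
    _ = 1 / (2 * δ) * (μ * (1 - μ) / N) + δ / 2 := by
        rw [binomExp_add, binomExp_const_mul, binomExp_variance hN, binomExp_const]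
    _ ≤ 1 / (2 * δ) * δ ^ 2 + δ / 2 := by gcongr
    _ = δ := by field_simp; ring

lemma gMmrc_eq (ε : ℝ) {μ θ : ℝ} :
    gMmrc ε μ θ = Real.exp ε * μ / (Real.exp ε * μ + (1 - μ)) +
      ((Real.exp ε + 1) / (2 * (Real.exp ε * μ + (1 - μ))) * (θ - μ) +
        -((Real.exp ε - 1) / (2 * (Real.exp ε * μ + (1 - μ)))) * |θ - μ|) := by
  rw [gMmrc]
  generalize Real.exp ε * μ + (1 - μ) = a
  rw [div_mul_eq_div_div, div_mul_eq_div_div]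
  split_ifs with h
  · rw [abs_of_nonpos (by linarith)]
    ring
  · rw [abs_of_pos (by linarith)]
    ring

/-- The mean absolute deviation of the in-cap fraction controls the loss of in-cap probability. -/
lemma binomExp_gMmrc_ge {N : ℕ} (hN : 0 < N) {ε μ δ : ℝ} (hε : 0 ≤ ε) (h0 : 0 ≤ μ) (h1 : μ ≤ 1)
    (hδ : 0 < δ) (h : μ * (1 - μ) / N ≤ δ ^ 2) :
    Real.exp ε * μ / (Real.exp ε * μ + (1 - μ)) -
        (Real.exp ε - 1) / (2 * (Real.exp ε * μ + (1 - μ))) * δ ≤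
      binomExp N μ (gMmrc ε μ) := by
  have hE : 0 ≤ Real.exp ε - 1 := by linarith [Real.one_le_exp hε]
  have ha : 0 ≤ Real.exp ε * μ + (1 - μ) :=
    add_nonneg (by positivity) (by linarith)
  rw [show gMmrc ε μ = _ from funext fun θ => gMmrc_eq ε, binomExp_add, binomExp_add,
    binomExp_const_mul, binomExp_const_mul, binomExp_const, binomExp_sub_mean hN]
  have := mul_le_mul_of_nonneg_left (binomExp_abs_sub_le hN h0 h1 hδ h)
    (div_nonneg hE (mul_nonneg zero_le_two ha))
  linarith

/-- A function of the number of candidates satisfying `P`, averaged over i.i.d. uniform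
candidates, is a binomial expectation. -/
lemma sum_piFinset_card_filter {α : Type*} (N : ℕ) (S : Finset α) (hS : S.Nonempty) (P : α → Prop)
    [DecidablePred P] (F : ℝ → ℝ) :
    ∑ zs ∈ Fintype.piFinset (fun _ : Fin N => S),
        (1 / (#S : ℝ)) ^ N * F ((#{i | P (zs i)} : ℝ) / N) =
      binomExp N ((#(S.filter P) : ℝ) / #S) F := by
  have hS' : (#S : ℝ) ≠ 0 := by exact_mod_cast hS.card_pos.ne'
  have hc : (1 : ℝ) - (#(S.filter P) : ℝ) / #S = (#(S.filter fun x => ¬ P x) : ℝ) / #S := by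
    have : (#(S.filter P) : ℝ) + #(S.filter fun x => ¬ P x) = #S := by
      exact_mod_cast S.card_filter_add_card_filter_not P
    field_simp
    linarith
  rw [binomExp, hc]
  set c₁ := #(S.filter P)
  set c₀ := #(S.filter fun x => ¬ P x)
  have fiber (t : Finset (Fin N)) :
      #{zs ∈ Fintype.piFinset (fun _ : Fin N => S) | ({i | P (zs i)} : Finset (Fin N)) = t} =
        c₁ ^ #t * c₀ ^ (N - #t) := by
    have : {zs ∈ Fintype.piFinset (fun _ : Fin N => S) | ({i | P (zs i)} : Finset (Fin N)) = t} =
        Fintype.piFinset fun i => if i ∈ t then S.filter P else S.filter fun x => ¬ P x := by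
      ext zs
      simp only [mem_filter, Fintype.mem_piFinset, Finset.ext_iff, mem_univ, true_and]
      rw [← forall_and]
      refine forall_congr' fun i => ?_
      split_ifs with hi <;> simp [hi]
    rw [this, Fintype.card_piFinset]
    simp only [apply_ite Finset.card]
    rw [Finset.prod_ite, Finset.prod_const, Finset.prod_const,
      show ({x | x ∉ t} : Finset (Fin N)) = tᶜ by ext; simp, Finset.card_compl, Fintype.card_fin,
      Finset.filter_univ_mem]
  rw [← Finset.sum_fiberwise_of_maps_to
    (g := fun zs : Fin N → α => ({i | P (zs i)} : Finset (Fin N)))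
    (t := (Finset.univ : Finset (Fin N)).powerset) (by simp)]
  have h := Finset.sum_powerset_apply_card (x := (Finset.univ : Finset (Fin N)))
    fun M => ((c₁ : ℝ) / #S) ^ M * ((c₀ : ℝ) / #S) ^ (N - M) * F ((M : ℝ) / N)
  simp only [Finset.card_univ, Fintype.card_fin, nsmul_eq_mul] at h
  trans ∑ t ∈ (Finset.univ : Finset (Fin N)).powerset,
      ((c₁ : ℝ) / #S) ^ #t * ((c₀ : ℝ) / #S) ^ (N - #t) * F ((#t : ℝ) / N)
  · refine Finset.sum_congr rfl fun t _ => ?_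
    rw [Finset.sum_congr rfl (g := fun _ => (1 / (#S : ℝ)) ^ N * F ((#t : ℝ) / N))
      fun zs hzs => by rw [(Finset.mem_filter.1 hzs).2], Finset.sum_const, fiber, nsmul_eq_mul]
    have ht : #t ≤ N := by simpa using Finset.card_le_univ t
    rw [div_pow, div_pow, div_pow, one_pow]
    have hpow : (#S : ℝ) ^ N = (#S : ℝ) ^ #t * (#S : ℝ) ^ (N - #t) := by
      rw [← pow_add, Nat.add_sub_cancel' ht]
    rw [hpow]
    push_cast
    field_simp
  · rw [h]
    exact Finset.sum_congr rfl fun _ _ => by ring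

lemma card_zset_filter_notMem {d s : ℕ} (j : Fin d) :
    #{A ∈ zset d s | j ∉ A} = (d - 1).choose s := by
  have : {A ∈ zset d s | j ∉ A} = Finset.powersetCard s (Finset.univ.erase j) := by
    ext A
    simp only [zset, mem_filter, mem_powersetCard, subset_univ, true_and]
    rw [Finset.subset_erase]
    simp [and_comm]
  rw [this, Finset.card_powersetCard]
  simp

lemma card_zset_filter_mem {d s : ℕ} (hs : 0 < s) (j : Fin d) :
    #{A ∈ zset d s | j ∈ A} = (d - 1).choose (s - 1) := by
  obtain ⟨d, rfl⟩ : ∃ e, d = e + 1 := ⟨d - 1, by have := j.pos; omega⟩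
  obtain ⟨s, rfl⟩ : ∃ e, s = e + 1 := ⟨s - 1, by omega⟩
  have h := card_zset_filter_notMem (s := s + 1) j
  have h2 := (zset (d + 1) (s + 1)).card_filter_add_card_filter_not (fun A => j ∈ A)
  rw [h, zset, Finset.card_powersetCard, Finset.card_univ, Fintype.card_fin,
    Nat.choose_succ_succ] at h2
  simpa [zset] using h2

lemma zset_nonempty {d s : ℕ} (hs : s ≤ d) : (zset d s).Nonempty :=
  Finset.powersetCard_nonempty.2 (by simpa using hs)

lemma card_filter_mem_div_card_zset {d s : ℕ} (hs0 : 0 < s) (hsd : s ≤ d) (j : Fin d) :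
    (#{A ∈ zset d s | j ∈ A} : ℝ) / #(zset d s) = s / d := by
  obtain ⟨d, rfl⟩ : ∃ e, d = e + 1 := ⟨d - 1, by omega⟩
  obtain ⟨s, rfl⟩ : ∃ e, s = e + 1 := ⟨s - 1, by omega⟩
  have hc : (0 : ℝ) < #(zset (d + 1) (s + 1)) := by exact_mod_cast (zset_nonempty hsd).card_pos
  have hd : (0 : ℝ) < (d + 1 : ℕ) := by positivity
  rw [div_eq_div_iff hc.ne' hd.ne', card_zset_filter_mem hs0, zset, Finset.card_powersetCard,
    Finset.card_univ, Fintype.card_fin]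
  norm_cast
  have := Nat.add_one_mul_choose_eq d s
  simp only [Nat.add_sub_cancel]
  linarith

/-- Mean squared error of the estimator `(z - b)/m` under any output distribution on `zset d s`
for which it is unbiased. -/
lemma sum_mul_sq_err {d s : ℕ} (hd : 0 < d) (j : Fin d) (w : Finset (Fin d) → ℝ) {γ b m : ℝ}
    (hm : m ≠ 0) (hw : ∑ A ∈ zset d s, w A = 1)
    (hγ : ∑ A ∈ zset d s, w A * (if j ∈ A then 1 else 0) = γ)
    (hmb : γ - b = m) (hb : d * b = s - m) :
    ∑ A ∈ zset d s, w A *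
        ∑ i : Fin d, (((if i ∈ A then (1 : ℝ) else 0) - b) / m - (if i = j then 1 else 0)) ^ 2 =
      s * (d - s) / (d * m ^ 2) - (d - 1) / d := by
  have inner : ∀ A ∈ zset d s,
      ∑ i : Fin d, (((if i ∈ A then (1 : ℝ) else 0) - b) / m - (if i = j then 1 else 0)) ^ 2 =
        ((s - 2 * b * s + d * b ^ 2) / m ^ 2 + 2 * b / m + 1) +
          -(2 / m) * (if j ∈ A then 1 else 0) := by
    intro A hA
    have hcard : ∑ i : Fin d, (if i ∈ A then (1 : ℝ) else 0) = s := by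
      simp [(Finset.mem_powersetCard.1 hA).2]
    have expand (i : Fin d) :
        (((if i ∈ A then (1 : ℝ) else 0) - b) / m - (if i = j then 1 else 0)) ^ 2 =
          (1 - 2 * b) / m ^ 2 * (if i ∈ A then (1 : ℝ) else 0) + b ^ 2 / m ^ 2 +
            (if i = j then 2 * b / m + 1 - 2 / m * (if j ∈ A then 1 else 0) else 0) := by
      by_cases hij : i = j
      · subst hij
        split_ifs <;> simp <;> field_simp <;> ring
      · simp only [hij, if_false]
        split_ifs
        · simp
          field_simp
          ring
        · simp
          field_simp
    rw [Finset.sum_congr rfl fun i _ => expand i, Finset.sum_add_distrib, Finset.sum_add_distrib,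
      ← Finset.mul_sum, hcard, Finset.sum_const, Finset.card_univ, Fintype.card_fin,
      Finset.sum_ite_eq' Finset.univ j, if_pos (Finset.mem_univ j), nsmul_eq_mul]
    ring
  rw [Finset.sum_congr rfl fun A hA => by rw [inner A hA, mul_add, mul_left_comm (w A) (-_)],
    Finset.sum_add_distrib, ← Finset.sum_mul, ← Finset.mul_sum, hw, hγ]
  have hd' : (d : ℝ) ≠ 0 := by positivity
  obtain rfl : b = (s - m) / d := by field_simp; linarith
  obtain rfl : γ = m + (s - m) / d := by linarith
  field_simp
  ring

lemma sum_qMmrcOut_mul {d s N : ℕ} (ε : ℝ) (j : Fin d) (f : Finset (Fin d) → ℝ) :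
    ∑ A ∈ zset d s, qMmrcOut d s N ε j A * f A =
      ∑ zs ∈ Fintype.piFinset (fun _ : Fin N => zset d s),
        (1 / (#(zset d s) : ℝ)) ^ N * ∑ k, piMmrcSS d s N ε j zs k * f (zs k) := by
  simp only [qMmrcOut, Finset.sum_mul]
  rw [Finset.sum_comm]
  refine Finset.sum_congr rfl fun zs hzs => ?_
  simp only [mul_assoc, Finset.sum_mul, ← Finset.mul_sum]
  rw [Finset.sum_comm]
  congr 1
  refine Finset.sum_congr rfl fun k _ => ?_
  simp only [ite_mul, zero_mul]
  rw [Finset.sum_ite_eq, if_pos (Fintype.mem_piFinset.1 hzs k)]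

lemma sum_ite_card {N : ℕ} (P : Fin N → Prop) [DecidablePred P] (u v : ℝ) :
    ∑ k, (if P k then u else v) =
      (#{k | P k} : ℝ) * u + (N - (#{k | P k} : ℝ)) * v := by
  have : (#{k | ¬ P k} : ℝ) = N - #{k | P k} := by
    have := (Finset.univ : Finset (Fin N)).card_filter_add_card_filter_not P
    rw [Finset.card_univ, Fintype.card_fin] at this
    rw [eq_sub_iff_add_eq']
    exact_mod_cast this
  rw [Finset.sum_ite, Finset.sum_const, Finset.sum_const, nsmul_eq_mul, nsmul_eq_mul, this]

lemma sum_ite_mul_boole_card {N : ℕ} (P : Fin N → Prop) [DecidablePred P] (u v : ℝ) :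
    ∑ k, (if P k then u else v) * (if P k then 1 else 0) = (#{k | P k} : ℝ) * u := by
  trans ∑ k, if P k then u else 0
  · exact Finset.sum_congr rfl fun k _ => by split_ifs <;> simp
  · rw [sum_ite_card, mul_zero, add_zero]

lemma sum_piMmrcSS_mul {d s N : ℕ} (hN : 0 < N) (hs0 : 0 < s) (hsd : s < d) (ε : ℝ) (j : Fin d)
    (zs : Fin N → Finset (Fin d)) :
    ∑ k, piMmrcSS d s N ε j zs k = 1 ∧
    ∑ k, piMmrcSS d s N ε j zs k * (if j ∈ zs k then 1 else 0) =
      gMmrc ε ((s : ℝ) / d) ((#{i | j ∈ zs i} : ℝ) / N) := by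
  have hN' : (N : ℝ) ≠ 0 := by positivity
  have hd : (0 : ℝ) < d := by exact_mod_cast hs0.trans hsd
  have hμ0 : (0 : ℝ) < (s : ℝ) / d := by positivity
  have hμ1 : (s : ℝ) / d < 1 := (div_lt_one hd).2 (by exact_mod_cast hsd)
  obtain ⟨θ, hθ⟩ : ∃ θ, (#{i | j ∈ zs i} : ℝ) / N = θ := ⟨_, rfl⟩
  have hM : (#{i | j ∈ zs i} : ℝ) = N * θ := by rw [← hθ]; field_simp
  have hout : (N : ℝ) - N * θ = N * (1 - θ) := by ring
  simp only [piMmrcSS, gMmrc, hθ]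
  generalize (s : ℝ) / d = μ at *
  have hE := Real.exp_pos ε
  have ha : Real.exp ε * μ + (1 - μ) ≠ 0 := by nlinarith [mul_pos hE hμ0]
  rcases lt_trichotomy θ μ with h | rfl | h
  · have : 1 - θ ≠ 0 := by linarith
    simp only [if_pos h, if_pos h.le, sum_ite_card, sum_ite_mul_boole_card, hM, hout]
    constructor
    · field_simp
      ring
    · field_simp
  · simp only [lt_irrefl, le_refl, if_true, if_false, sum_ite_card, sum_ite_mul_boole_card, hM,
      hout]
    constructor
    · have ha' : θ * Real.exp ε + (1 - θ) ≠ 0 := by rwa [mul_comm θ]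
      field_simp
    · field_simp
  · have : θ ≠ 0 := by linarith
    simp only [if_neg h.not_gt, if_pos h, if_neg h.not_ge, sum_ite_card, sum_ite_mul_boole_card,
      hM, hout]
    constructor
    · field_simp
      ring
    · field_simp
      ring

lemma sum_qMmrcOut {d s N : ℕ} (hN : 0 < N) (hs0 : 0 < s) (hsd : s < d) (ε : ℝ) (j : Fin d) :
    ∑ A ∈ zset d s, qMmrcOut d s N ε j A = 1 := by
  have h := sum_qMmrcOut_mul (s := s) (N := N) ε j fun _ => 1
  simp only [mul_one, (sum_piMmrcSS_mul hN hs0 hsd ε j _).1] at h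
  rw [h]
  have := sum_piFinset_card_filter N (zset d s) (zset_nonempty hsd.le) (fun A => j ∈ A) fun _ => 1
  simpa only [mul_one, binomExp_const] using this

lemma sum_qMmrcOut_mem {d s N : ℕ} (hN : 0 < N) (hs0 : 0 < s) (hsd : s < d) (ε : ℝ) (j : Fin d) :
    ∑ A ∈ zset d s, qMmrcOut d s N ε j A * (if j ∈ A then 1 else 0) = egMmrc d s N ε := by
  have h := sum_qMmrcOut_mul (s := s) (N := N) ε j fun A => if j ∈ A then 1 else 0
  simp only [(sum_piMmrcSS_mul hN hs0 hsd ε j _).2] at h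
  rw [h, egMmrc, ← card_filter_mem_div_card_zset hs0 hsd.le j]
  exact sum_piFinset_card_filter N (zset d s) (zset_nonempty hsd.le) (fun A => j ∈ A) _

lemma errMmrcOne_eq {d s N : ℕ} (hd : 2 ≤ d) (hN : 0 < N) (hs0 : 0 < s) (hsd : s < d) (ε : ℝ)
    (j : Fin d) (hm : mMmrcSS d s N ε ≠ 0) :
    errMmrcOne d s N ε j = s * (d - s) / (d * mMmrcSS d s N ε ^ 2) - (d - 1) / d := by
  have hd1 : (d : ℝ) - 1 ≠ 0 := by
    have : (2 : ℝ) ≤ d := by exact_mod_cast hd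
    linarith
  refine sum_mul_sq_err (by omega) j _ hm (sum_qMmrcOut hN hs0 hsd ε j)
    (sum_qMmrcOut_mem hN hs0 hsd ε j) ?_ ?_
  · rw [bMmrcSS, mMmrcSS]
    field_simp
    ring
  · rw [bMmrcSS, mMmrcSS]
    field_simp
    ring

lemma errSSone_eq {d s : ℕ} (hd : 2 ≤ d) (hs0 : 0 < s) (hsd : s < d) {ε : ℝ} (hε : 0 < ε)
    (j : Fin d) :
    errSSone d s ε j = s * (d - s) / (d * mss d s ε ^ 2) - (d - 1) / d := by
  have hd1 : (0 : ℝ) < (d : ℝ) - 1 := by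
    have : (2 : ℝ) ≤ d := by exact_mod_cast hd
    linarith
  have hd0 : (0 : ℝ) < d := by linarith
  have hs0' : (0 : ℝ) < s := by exact_mod_cast hs0
  have hsd' : (0 : ℝ) < (d : ℝ) - s := sub_pos.2 (by exact_mod_cast hsd)
  have hE : 0 < Real.exp ε - 1 := sub_pos.2 (Real.one_lt_exp_iff.2 hε)
  have hD : 0 < s * (Real.exp ε - 1) + d := by positivity
  have hm : mss d s ε ≠ 0 := by
    rw [mss]
    positivity
  have hC : 0 < qssC d s ε := by
    have : 0 < (d - 1).choose s := Nat.choose_pos (by omega)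
    rw [qssC]
    positivity
  have hp : ((d - 1).choose (s - 1) : ℝ) * (Real.exp ε / qssC d s ε) =
      s * Real.exp ε / (s * (Real.exp ε - 1) + d) := by
    have key : ((d - 1).choose s : ℝ) * s = (d - 1).choose (s - 1) * (d - s) := by
      have := Nat.choose_succ_right_eq (d - 1) (s - 1)
      rw [Nat.sub_add_cancel hs0, show d - 1 - (s - 1) = d - s by omega] at this
      rw [← Nat.cast_sub hsd.le]
      exact_mod_cast this
    rw [mul_div_assoc', div_eq_div_iff hC.ne' hD.ne', qssC]
    linear_combination -Real.exp ε * key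
  have hsum : ∑ A ∈ zset d s, qss d s ε j A = 1 := by
    simp only [qss]
    rw [Finset.sum_ite, Finset.sum_const, Finset.sum_const, card_zset_filter_mem hs0,
      card_zset_filter_notMem, nsmul_eq_mul, nsmul_eq_mul]
    field_simp
    rw [qssC]
  have hmem : ∑ A ∈ zset d s, qss d s ε j A * (if j ∈ A then 1 else 0) =
      s * Real.exp ε / (s * (Real.exp ε - 1) + d) := by
    simp only [qss, mul_ite, mul_one, mul_zero]
    rw [← Finset.sum_filter, Finset.sum_congr rfl fun A hA => if_pos (Finset.mem_filter.1 hA).2,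
      Finset.sum_const, card_zset_filter_mem hs0, nsmul_eq_mul, hp]
  refine sum_mul_sq_err (by omega) j _ hm hsum hmem ?_ ?_
  · rw [bss, mss]
    field_simp
    ring
  · rw [bss, mss]
    field_simp
    ring

/-- If the mean absolute deviation is a small fraction of the variance, then the MMRC scaling
factor is close to the Subset Selection one. -/
lemma mMmrcSS_ge {d s N : ℕ} (hd : 2 ≤ d) (hN : 0 < N) (hs0 : 0 < s) (hsd : s < d) {ε r : ℝ}
    (hε : 0 ≤ ε) (hr : 0 < r) (h : (d : ℝ) ^ 2 ≤ 4 * N * (s * (d - s)) * r ^ 2) :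
    mss d s ε * (1 - r) ≤ mMmrcSS d s N ε := by
  have hd2 : (2 : ℝ) ≤ d := by exact_mod_cast hd
  have hd1 : (0 : ℝ) < (d : ℝ) - 1 := by linarith
  have hd0 : (0 : ℝ) < d := by linarith
  have hs0' : (0 : ℝ) < s := by exact_mod_cast hs0
  have hN' : (0 : ℝ) < N := by exact_mod_cast hN
  have hsd' : (0 : ℝ) < (d : ℝ) - s := sub_pos.2 (by exact_mod_cast hsd)
  have hE : 0 ≤ Real.exp ε - 1 := by linarith [Real.one_le_exp hε]
  have hD : 0 < s * (Real.exp ε - 1) + d := by positivity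
  have ha : Real.exp ε * (s / d) + (1 - s / d) = (s * (Real.exp ε - 1) + d) / d := by
    field_simp
    ring
  have hγ := binomExp_gMmrc_ge hN hε (μ := (s : ℝ) / d) (δ := 2 * (s * (d - s) / d ^ 2) * r)
    (by positivity) ((div_le_one hd0).2 (by linarith)) (by positivity) (by
      rw [div_le_iff₀ hN', ← sub_nonneg]
      have : (2 * (s * (d - s) / d ^ 2) * r) ^ 2 * N - s / d * (1 - s / d) =
          s * (d - s) / d ^ 4 * (4 * N * (s * (d - s)) * r ^ 2 - d ^ 2) := by
        field_simp
        ring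
      rw [this]
      exact mul_nonneg (by positivity) (sub_nonneg.2 h))
  rw [mMmrcSS, egMmrc]
  refine le_trans (le_of_eq ?_) (sub_le_sub_right (mul_le_mul_of_nonneg_left hγ (by positivity)) _)
  rw [ha, mss]
  field_simp
  ring

/-- Comparison of two errors of the form `C / m² - κ` when `m` is close to `M`. -/
lemma div_sq_sub_le {C κ m M r lam : ℝ} (hC : 0 ≤ C) (hM : 0 < M) (hr0 : 0 ≤ r) (hr : r ≤ 1 / 10)
    (hlam : 0 ≤ lam) (hm : M * (1 - r) ≤ m) (hκ : κ ≤ C / M ^ 2)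
    (h : 3 * r * (C / M ^ 2) ≤ 4 * lam * (C / M ^ 2 - κ)) :
    C / m ^ 2 - κ ≤ (1 + 4 * lam + 5 * lam ^ 2 + 2 * lam ^ 3) * (C / M ^ 2 - κ) := by
  have hr1 : 0 < 1 - r := by linarith
  have hR : 0 ≤ C / M ^ 2 := by positivity
  have h1 : C / m ^ 2 ≤ C / M ^ 2 * (1 + 3 * r) := calc
    C / m ^ 2 ≤ C / (M * (1 - r)) ^ 2 := by gcongr
    _ = C / M ^ 2 * (1 / (1 - r) ^ 2) := by field_simp
    _ ≤ C / M ^ 2 * (1 + 3 * r) := by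
      gcongr
      rw [div_le_iff₀ (by positivity)]
      nlinarith [mul_nonneg hr0 (sub_nonneg.2 hr), pow_nonneg hr0 3]
  have h2 : 0 ≤ (5 * lam ^ 2 + 2 * lam ^ 3) * (C / M ^ 2 - κ) :=
    mul_nonneg (by positivity) (sub_nonneg.2 hκ)
  linarith

lemma two_mul_ceil_le {d : ℕ} (hd : 2 ≤ d) {x : ℝ} (hx : 3 ≤ x) : 2 * ⌈(d : ℝ) / x⌉₊ ≤ d := by
  have : ⌈(d : ℝ) / x⌉₊ ≤ (d + 2) / 3 := by
    rw [Nat.ceil_le, div_le_iff₀ (by linarith)]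
    have h : (d : ℝ) ≤ ((d + 2) / 3 : ℕ) * 3 := by exact_mod_cast (by omega : d ≤ (d + 2) / 3 * 3)
    exact h.trans (by gcongr)
  omega

/-- The number of candidates is at least `34 (E + 1)² (1 + λ⁻¹)²`. -/
lemma num_candidates_ge {E lam N : ℝ} (hlam : 0 < lam)
    (hN : N ≥ 2 * (E + 1) ^ 2 * (1 + lam) ^ 2 / ((0.24 : ℝ) ^ 2 * lam ^ 2) *
        Real.log (8 * (1 + lam) / ((0.24 : ℝ) * lam))) :
    34 * (E + 1) ^ 2 * (1 + lam) ^ 2 ≤ N * lam ^ 2 := by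
  have hlog : 1 ≤ Real.log (8 * (1 + lam) / ((0.24 : ℝ) * lam)) := by
    rw [Real.le_log_iff_exp_le (by positivity), le_div_iff₀ (by positivity)]
    nlinarith [Real.exp_one_lt_d9]
  have h : 2 * (E + 1) ^ 2 * (1 + lam) ^ 2 / ((0.24 : ℝ) ^ 2 * lam ^ 2) ≤ N :=
    (le_mul_of_one_le_right (by positivity) hlog).trans hN
  rw [div_le_iff₀ (by positivity)] at h
  have : 0 ≤ (E + 1) ^ 2 * (1 + lam) ^ 2 := by positivity
  linarith

/-- The relative loss `r` of the scaling factor is negligible compared with the Subset Selection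
error when a single coordinate is selected. -/
lemma gap_of_le {d E N lam r : ℝ} (hd : 2 ≤ d) (hE : 2 ≤ E) (hdE : d ≤ 1 + E) (hlam : 0 < lam)
    (hN : 34 * (E + 1) ^ 2 ≤ N * lam ^ 2)
    (hr : ∀ c, 0 ≤ c → d ^ 2 ≤ 4 * N * (d - 1) * c ^ 2 → r ≤ c) :
    (d - 1) / d ≤ (d - 1) / d * (1 + d / (E - 1)) ^ 2 ∧
      3 * r * ((d - 1) / d * (1 + d / (E - 1)) ^ 2) ≤
        4 * lam * ((d - 1) / d * (1 + d / (E - 1)) ^ 2 - (d - 1) / d) := by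
  have hE1 : 0 < E - 1 := by linarith
  have hd1 : 0 < d - 1 := by linarith
  have hd0 : 0 < d := by linarith
  have hrq : r ≤ lam * (d / (1 + E)) / 5 := by
    refine hr _ (by positivity) ?_
    have h1 : 4 * N * (d - 1) * (lam * (d / (1 + E)) / 5) ^ 2 =
        4 / 25 * (d - 1) * d ^ 2 * (N * lam ^ 2 / (1 + E) ^ 2) := by
      field_simp
      norm_num
    have h2 : 34 ≤ N * lam ^ 2 / (1 + E) ^ 2 := by
      rw [le_div_iff₀ (by positivity)]
      linarith
    rw [h1]
    calc d ^ 2 ≤ 4 / 25 * 1 * d ^ 2 * 34 := by linarith [sq_nonneg d]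
      _ ≤ _ := by gcongr; linarith
  have hq1 : d / (1 + E) ≤ 1 := div_le_one_of_le₀ hdE (by linarith)
  have hqt : d / (1 + E) ≤ d / (E - 1) := by
    gcongr
    linarith
  have ht0 : 0 < d / (E - 1) := by positivity
  have hκ0 : 0 < (d - 1) / d := by positivity
  generalize d / (1 + E) = q at *
  generalize d / (E - 1) = t at *
  generalize (d - 1) / d = κ at *
  have ht1 : 1 ≤ (1 + t) ^ 2 := one_le_pow₀ (by linarith)
  have hgap : q * (1 + t) ^ 2 ≤ 2 * ((1 + t) ^ 2 - 1) := by
    have h1 := mul_le_mul_of_nonneg_right hq1 ht0.le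
    have h2 := mul_le_mul_of_nonneg_right hq1 (sq_nonneg t)
    linarith [sq_nonneg t]
  have h1 := mul_le_mul_of_nonneg_left hgap (mul_pos hκ0 hlam).le
  have h2 := mul_le_mul_of_nonneg_right hrq (show 0 ≤ κ * (1 + t) ^ 2 by positivity)
  have h3 : 0 ≤ κ * lam * ((1 + t) ^ 2 - 1) :=
    mul_nonneg (by positivity) (by linarith)
  exact ⟨le_mul_of_one_le_right hκ0.le ht1, by linarith⟩

lemma four_mul_le_of_gt {d E s : ℝ} (hd : 2 ≤ d) (hE : 2 ≤ E) (hdE : 1 + E < d) (hs : 1 ≤ s)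
    (hsd : s < d) :
    4 * ((d - 1) / d) ≤
      (d - 1) ^ 2 * (s * (E - 1) + d) ^ 2 / (d * (s * (d - s)) * (E - 1) ^ 2) := by
  have hE1 : 0 < E - 1 := by linarith
  have hd1 : 0 < d - 1 := by linarith
  have hds : 0 < d - s := by linarith
  calc 4 * ((d - 1) / d) = (d - 1) / d * 4 := by ring
    _ ≤ (d - 1) / d * ((d - 1) * (s * (E - 1) + d) ^ 2 / (s * (d - s) * (E - 1) ^ 2)) := by
      gcongr
      rw [le_div_iff₀ (by positivity)]
      calc 4 * (s * (d - s) * (E - 1) ^ 2) = (d - s) * (E - 1) * (4 * (s * (E - 1))) := by ring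
        _ ≤ (d - 1) * d * (4 * (s * (E - 1))) := by
          gcongr
          linarith
        _ = (d - 1) * (4 * (s * (E - 1)) * d) := by ring
        _ ≤ (d - 1) * (s * (E - 1) + d) ^ 2 := by
          gcongr
          linarith [sq_nonneg (s * (E - 1) - d)]
    _ = _ := by field_simp

/-- **Theorem 7.**  If `ε ≤ d−1` and `N ≥ 2(e^ε+1)²(1+λ)²/(0.24²λ²)·ln(8(1+λ)/(0.24λ))`,
then for every deterministic one-hot input the mean squared error of MMRC simulating Subset
Selection is at most `(1+4λ+5λ²+2λ³)` times that of Subset Selection. -/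
theorem mmrc_ss_utility
    (d : ℕ) (hd : 2 ≤ d) (ε : ℝ) (hε1 : 1 ≤ ε) (hεd : ε ≤ (d : ℝ) - 1)
    (s : ℕ) (hs : s = ⌈(d : ℝ) / (1 + Real.exp ε)⌉₊)
    (lam : ℝ) (hlam : 0 < lam)
    (N : ℕ) (hN0 : 0 < N)
    (hN : (N : ℝ) ≥ 2 * (Real.exp ε + 1) ^ 2 * (1 + lam) ^ 2 / ((0.24 : ℝ) ^ 2 * lam ^ 2) *
        Real.log (8 * (1 + lam) / ((0.24 : ℝ) * lam))) :
    ∀ j : Fin d,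
      errMmrcOne d s N ε j ≤ (1 + 4 * lam + 5 * lam ^ 2 + 2 * lam ^ 3) * errSSone d s ε j := by
  intro j
  obtain ⟨E, hE⟩ : ∃ E, Real.exp ε = E := ⟨_, rfl⟩
  have hE2 : 2 ≤ E := by linarith [Real.exp_one_gt_d9, Real.exp_le_exp.2 hε1]
  have hd2 : (2 : ℝ) ≤ d := by exact_mod_cast hd
  have hN' : (0 : ℝ) < N := by exact_mod_cast hN0
  rw [hE] at hs hN
  have hNl := num_candidates_ge hlam hN
  have hs0 : 0 < s := hs ▸ Nat.ceil_pos.2 (by positivity)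
  have h2s : 2 * s ≤ d := hs ▸ two_mul_ceil_le hd (by linarith)
  have hsd : s < d := by omega
  have hs1 : (1 : ℝ) ≤ s := by exact_mod_cast hs0
  have h2s' : 2 * (s : ℝ) ≤ d := by exact_mod_cast h2s
  have hds : (0 : ℝ) < (d : ℝ) - s := by linarith
  have hsE : (d : ℝ) ≤ s * (1 + E) := by
    rw [← div_le_iff₀ (by linarith), hs]
    exact Nat.le_ceil _
  have hE1 : 0 < E - 1 := by linarith
  have hD : 0 < s * (E - 1) + d := by positivity
  have hd1 : (0 : ℝ) < (d : ℝ) - 1 := by linarith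
  have hd0 : (0 : ℝ) < d := by linarith
  have hmss : 0 < mss d s ε := by
    rw [mss, hE]
    positivity
  have hC : (0 : ℝ) ≤ s * (d - s) / d := by positivity
  have hR : s * (d - s) / d / mss d s ε ^ 2 =
      (d - 1) ^ 2 * (s * (E - 1) + d) ^ 2 / (d * (s * (d - s)) * (E - 1) ^ 2) := by
    rw [mss, hE]
    field_simp
  set r : ℝ := Real.sqrt ((d : ℝ) ^ 2 / (4 * N * (s * (d - s)))) with hr
  have hr0 : 0 < r := Real.sqrt_pos.2 (by positivity)
  have hrsq : (d : ℝ) ^ 2 ≤ 4 * N * (s * (d - s)) * r ^ 2 := by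
    rw [hr, Real.sq_sqrt (by positivity), mul_div_cancel₀ _ (by positivity)]
  have r_le {c : ℝ} (hc : 0 ≤ c) (h : (d : ℝ) ^ 2 ≤ 4 * N * (s * (d - s)) * c ^ 2) : r ≤ c := by
    refine Real.sqrt_le_left hc |>.2 ?_
    rw [div_le_iff₀ (by positivity)]
    linarith
  have hvar : (d : ℝ) ^ 2 ≤ 2 * (1 + E) * (s * (d - s)) := by
    nlinarith [mul_le_mul_of_nonneg_right hsE hds.le]
  have hNE : 34 * (E + 1) ^ 2 ≤ N := by
    have : 34 * (E + 1) ^ 2 * lam ^ 2 ≤ N * lam ^ 2 := by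
      refine le_trans ?_ hNl
      gcongr
      linarith
    exact le_of_mul_le_mul_right this (by positivity)
  have hNlE : 34 * (E + 1) ^ 2 ≤ N * lam ^ 2 := by
    refine le_trans ?_ hNl
    exact le_mul_of_one_le_right (by positivity) (by nlinarith)
  have hvar' {c : ℝ} (h : 34 * (E + 1) ^ 2 ≤ N * c ^ 2) :
      (d : ℝ) ^ 2 ≤ 4 * N * (s * (d - s)) * (c / 10) ^ 2 := by
    have h1 : 34 * (E + 1) ^ 2 * (s * (d - s)) ≤ N * c ^ 2 * (s * (d - s)) := by gcongr
    have h2 : (E + 1) * d ^ 2 ≤ (E + 1) * (2 * (1 + E) * (s * (d - s))) := by gcongr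
    nlinarith
  have hm := mMmrcSS_ge (ε := ε) hd hN0 hs0 hsd (by linarith) hr0 hrsq
  have hr10 : r ≤ 1 / 10 := r_le (by norm_num) (hvar' (by linarith))
  have hm0 : 0 < mMmrcSS d s N ε :=
    (mul_pos hmss (by linarith)).trans_le hm
  rw [errMmrcOne_eq hd hN0 hs0 hsd ε j hm0.ne', errSSone_eq hd hs0 hsd (by linarith) j,
    ← div_div, ← div_div]
  obtain ⟨R, hRdef⟩ : ∃ R, s * (d - s) / d / mss d s ε ^ 2 = R := ⟨_, rfl⟩
  obtain ⟨κ, hκ⟩ : ∃ κ : ℝ, ((d : ℝ) - 1) / d = κ := ⟨_, rfl⟩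
  have hκ0 : 0 < κ := hκ ▸ div_pos hd1 hd0
  suffices κ ≤ R ∧ 3 * r * R ≤ 4 * lam * (R - κ) by
    refine div_sq_sub_le hC hmss hr0.le hr10 hlam.le hm ?_ ?_ <;> rw [hRdef, hκ]
    exacts [this.1, this.2]
  rcases le_or_gt (d : ℝ) (1 + E) with hdE | hdE
  · obtain rfl : s = 1 := by
      refine le_antisymm ?_ hs0
      rw [hs, Nat.ceil_le, Nat.cast_one]
      exact div_le_one_of_le₀ hdE (by linarith)
    have hRκ : R = (d - 1) / d * (1 + d / (E - 1)) ^ 2 := by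
      rw [← hRdef, hR, Nat.cast_one]
      field_simp
    rw [hRκ, ← hκ]
    refine gap_of_le hd2 hE2 hdE hlam hNlE fun c hc h => r_le hc ?_
    rwa [Nat.cast_one, one_mul]
  · have hR4 : 4 * κ ≤ R := by
      rw [← hRdef, hR, ← hκ]
      exact four_mul_le_of_gt hd2 hE2 hdE hs1 (by linarith)
    have hrl : r ≤ lam / 10 := r_le (by positivity) (hvar' hNlE)
    refine ⟨by linarith, ?_⟩
    have h1 := mul_le_mul_of_nonneg_right hrl (show 0 ≤ R by linarith)
    have h2 := mul_le_mul_of_nonneg_left hR4 hlam.le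
    have h3 := mul_pos hlam hκ0
    linarith
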